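/- Let A be an integer (r,s)×t bimatrix, let x ∈ ℤ^{nt} satisfy finite bounds l ≤ x ≤ u, and let ḡ = (ḡ¹,…,ḡⁿ) ∈ 𝒢(A⁽ⁿ⁾) be nonzero with l ≤ x + ḡ ≤ u. Let γ̄ be the largest positive integer with l ≤ x + γ̄ḡ ≤ u. Then there exists an index i ∈ {1,…,n} such that ḡⁱ ≠ 0, ḡⁱ ∈ Z(A), and γ̄ is the largest positive integer γ with lⁱ ≤ xⁱ + γḡⁱ ≤ uⁱ. -/

import Mathlib

open Matrix

/-- The conformal (sign-compatible) partial order `x ⊑ y` on integer vectors: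
`x k * y k ≥ 0` and `|x k| ≤ |y k|` for every coordinate `k`. -/
def ConformalLe {ν : Type*} (x y : ν → ℤ) : Prop :=
  ∀ k, 0 ≤ x k * y k ∧ |x k| ≤ |y k|

/-- The Graver basis of an integer matrix `A`: the set of `⊑`-minimal elements of
`{x : A x = 0, x ≠ 0}`. -/
def GraverBasis {μ ν : Type*} [Fintype ν] (A : Matrix μ ν ℤ) : Set (ν → ℤ) :=
  {x | A.mulVec x = 0 ∧ x ≠ 0 ∧
    ∀ y, A.mulVec y = 0 → y ≠ 0 → ConformalLe y x → y = x}

/-- The `ι`-fold product of the bimatrix with blocks `A1` (first block, `r × τ`) and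
`A2` (second block, `s × τ`): the first `r` rows are `(A1 A1 ⋯ A1)` and the remaining
rows form a block-diagonal matrix with a copy of `A2` for each index in `ι`. -/
def nFold {r s : ℕ} {τ : Type*} (A1 : Matrix (Fin r) τ ℤ) (A2 : Matrix (Fin s) τ ℤ)
    (ι : Type*) [DecidableEq ι] : Matrix (Fin r ⊕ ι × Fin s) (ι × τ) ℤ :=
  Matrix.of fun i jt =>
    match i with
    | Sum.inl a => A1 a jt.2
    | Sum.inr (k, c) => if jt.1 = k then A2 c jt.2 else 0

/-- The `i`-th brick of a vector indexed by `ι × τ`. -/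
def brick {ι τ : Type*} (x : ι × τ → ℤ) (i : ι) : τ → ℤ := fun j => x (i, j)

/-- The Graver complexity of the bimatrix `(A1, A2)`: the largest number of nonzero
bricks appearing in any element of the Graver basis of any `n`-fold product. -/
noncomputable def graverComplexity {r s t : ℕ} (A1 : Matrix (Fin r) (Fin t) ℤ)
    (A2 : Matrix (Fin s) (Fin t) ℤ) : ℕ :=
  sSup {k : ℕ | ∃ (n : ℕ) (g : Fin n × Fin t → ℤ),
    g ∈ GraverBasis (nFold A1 A2 (Fin n)) ∧
    k = {i : Fin n | brick g i ≠ 0}.ncard}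

/-- `Z(A)`: the set of all vectors in `ℤ^t` that are sums of at most `g(A)` elements
of the Graver basis of `A2`. -/
noncomputable def ZSet {r s t : ℕ} (A1 : Matrix (Fin r) (Fin t) ℤ)
    (A2 : Matrix (Fin s) (Fin t) ℤ) : Set (Fin t → ℤ) :=
  {z | ∃ L : List (Fin t → ℤ), L.length ≤ graverComplexity A1 A2 ∧
    (∀ h ∈ L, h ∈ GraverBasis A2) ∧ z = L.sum}

theorem conformalLe_iff {ν : Type*} {x y : ν → ℤ} :
    ConformalLe x y ↔ ∀ k, (0 ≤ x k ∧ x k ≤ y k) ∨ (y k ≤ x k ∧ x k ≤ 0) := by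
  refine forall_congr' fun k => ?_
  generalize x k = a
  generalize y k = b
  constructor
  · rintro ⟨hab, habs⟩
    rcases lt_trichotomy a 0 with ha | ha | ha
    · have hb : b ≤ 0 := by by_contra! hb; nlinarith
      rw [abs_of_neg ha, abs_of_nonpos hb] at habs
      omega
    · omega
    · have hb : 0 ≤ b := by by_contra! hb; nlinarith
      rw [abs_of_pos ha, abs_of_nonneg hb] at habs
      omega
  · rintro (⟨h1, h2⟩ | ⟨h1, h2⟩)
    · exact ⟨mul_nonneg h1 (h1.trans h2), by rwa [abs_of_nonneg h1, abs_of_nonneg (h1.trans h2)]⟩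
    · refine ⟨mul_nonneg_of_nonpos_of_nonpos h2 (h1.trans h2), ?_⟩
      rw [abs_of_nonpos h2, abs_of_nonpos (h1.trans h2)]
      omega

theorem ConformalLe.refl {ν : Type*} (x : ν → ℤ) : ConformalLe x x :=
  conformalLe_iff.2 fun k => by omega

theorem ConformalLe.trans {ν : Type*} {x y z : ν → ℤ} (hxy : ConformalLe x y)
    (hyz : ConformalLe y z) : ConformalLe x z := by
  rw [conformalLe_iff] at *
  intro k
  have := hxy k
  have := hyz k
  omega

theorem ConformalLe.sub {ν : Type*} {x y : ν → ℤ} (h : ConformalLe x y) :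
    ConformalLe (y - x) y := by
  rw [conformalLe_iff] at *
  intro k
  have := h k
  simp only [Pi.sub_apply]
  omega

/-- `x` lies in the same closed orthant as `y`, with zero coordinates wherever `y` has them. -/
def SignCompatible {ν : Type*} (x y : ν → ℤ) : Prop :=
  ∀ k, (0 ≤ y k → 0 ≤ x k) ∧ (y k ≤ 0 → x k ≤ 0)

theorem ConformalLe.signCompatible {ν : Type*} {x y : ν → ℤ} (h : ConformalLe x y) :
    SignCompatible x y := by
  rw [conformalLe_iff] at h
  intro k
  have := h k
  omega

theorem SignCompatible.multiset_sum {ν : Type*} {z : ν → ℤ} {M : Multiset (ν → ℤ)}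
    (h : ∀ x ∈ M, SignCompatible x z) : SignCompatible M.sum z := by
  refine Multiset.sum_induction (fun x => SignCompatible x z) M ?_ ?_ h
  · intro a b ha hb k
    have := ha k
    have := hb k
    simp only [Pi.add_apply]
    omega
  · intro k
    simp

theorem SignCompatible.conformalLe_add {ν : Type*} {x y z : ν → ℤ}
    (hx : SignCompatible x z) (hy : SignCompatible y z) : ConformalLe x (x + y) := by
  rw [conformalLe_iff]
  intro k
  have := hx k
  have := hy k
  simp only [Pi.add_apply]
  omega

theorem conformalLe_multiset_sum_of_le {ν : Type*} {z : ν → ℤ} {N M : Multiset (ν → ℤ)}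
    (h : ∀ x ∈ M, SignCompatible x z) (hNM : N ≤ M) : ConformalLe N.sum M.sum := by
  obtain ⟨K, rfl⟩ := Multiset.le_iff_exists_add.1 hNM
  rw [Multiset.sum_add]
  exact (SignCompatible.multiset_sum fun x hx => h x (by simp [hx])).conformalLe_add
    (SignCompatible.multiset_sum fun x hx => h x (by simp [hx]))

theorem eq_zero_of_multiset_sum_eq_zero {ν : Type*} {z : ν → ℤ} {M : Multiset (ν → ℤ)}
    (h : ∀ x ∈ M, SignCompatible x z) (hne : ∀ x ∈ M, x ≠ 0) (hM : M.sum = 0) : M = 0 := by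
  refine Multiset.eq_zero_of_forall_notMem fun x hx => hne x hx ?_
  have hle := conformalLe_multiset_sum_of_le h (Multiset.singleton_le.2 hx)
  rw [Multiset.sum_singleton, hM, conformalLe_iff] at hle
  funext k
  have := hle k
  simp only [Pi.zero_apply] at this ⊢
  omega

theorem finite_graverBasis {μ ν : Type*} [Fintype ν] (A : Matrix μ ν ℤ) :
    (GraverBasis A).Finite := by
  let φ : (ν → ℤ) → ν → ℕ × ℕ := fun x k => ((x k).toNat, (-x k).toNat)
  have hφ : ∀ x y, φ x ≤ φ y → ConformalLe x y := by
    intro x y h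
    rw [conformalLe_iff]
    intro k
    have h1 : (x k).toNat ≤ (y k).toNat := (h k).1
    have h2 : (-x k).toNat ≤ (-y k).toNat := (h k).2
    omega
  have hinj : Function.Injective φ := by
    intro x y h
    funext k
    have h1 : (x k).toNat = (y k).toNat := congrArg Prod.fst (congrFun h k)
    have h2 : (-x k).toNat = (-y k).toNat := congrArg Prod.snd (congrFun h k)
    omega
  refine Set.Finite.of_finite_image (f := φ) ?_ hinj.injOn
  refine WellQuasiOrderedLE.finite_of_isAntichain ?_
  rintro _ ⟨x, hx, rfl⟩ _ ⟨y, hy, rfl⟩ hxy hle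
  exact hxy (congrArg φ (hy.2.2 x hx.1 hx.2.1 (hφ x y hle)))

theorem ConformalLe.sum_natAbs_lt {ν : Type*} [Fintype ν] {x y : ν → ℤ}
    (h : ConformalLe x y) (hne : x ≠ y) : ∑ k, (x k).natAbs < ∑ k, (y k).natAbs := by
  rw [conformalLe_iff] at h
  obtain ⟨k, hk⟩ := Function.ne_iff.1 hne
  refine Finset.sum_lt_sum (fun i _ => ?_) ⟨k, Finset.mem_univ k, ?_⟩
  · have := h i
    omega
  · have := h k
    omega

/-- Every integer vector in the kernel is a conformal sum of Graver basis elements. -/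
theorem exists_conformal_graver_decomposition {μ ν : Type*} [Fintype ν] (A : Matrix μ ν ℤ)
    (z : ν → ℤ) (hz : A.mulVec z = 0) :
    ∃ M : Multiset (ν → ℤ), (∀ h ∈ M, h ∈ GraverBasis A) ∧ (∀ h ∈ M, ConformalLe h z) ∧
      M.sum = z := by
  induction hn : ∑ k, (z k).natAbs using Nat.strong_induction_on generalizing z with
  | _ n ih =>
    subst hn
    by_cases hz0 : z = 0
    · exact ⟨0, by simp, by simp, by simp [hz0]⟩
    by_cases hG : z ∈ GraverBasis A
    · exact ⟨{z}, by simpa using hG, by simpa using ConformalLe.refl z, by simp⟩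
    obtain ⟨y, hy, hy0, hyz, hne⟩ : ∃ y, A.mulVec y = 0 ∧ y ≠ 0 ∧ ConformalLe y z ∧ y ≠ z := by
      by_contra! hcon
      exact hG ⟨hz, hz0, hcon⟩
    obtain ⟨M, hM, hMy, hMs⟩ := ih _ (hyz.sum_natAbs_lt hne) y hy rfl
    obtain ⟨N, hN, hNy, hNs⟩ := ih _ (hyz.sub.sum_natAbs_lt (by simpa using hy0)) (z - y)
      (by rw [Matrix.mulVec_sub, hz, hy, sub_zero]) rfl
    refine ⟨M + N, ?_, ?_, by simp [hMs, hNs]⟩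
    · intro h hh
      exact (Multiset.mem_add.1 hh).elim (hM h) (hN h)
    · intro h hh
      exact (Multiset.mem_add.1 hh).elim (fun hh => (hMy h hh).trans hyz)
        (fun hh => (hNy h hh).trans hyz.sub)

theorem exists_le_eq_sum_of_le_sum {ι α : Type*} (s : Finset ι) (M : ι → Multiset α)
    {N : Multiset α} (h : N ≤ ∑ i ∈ s, M i) :
    ∃ P : ι → Multiset α, (∀ i ∈ s, P i ≤ M i) ∧ N = ∑ i ∈ s, P i := by
  classical
  induction s using Finset.induction_on generalizing N with
  | empty => exact ⟨fun _ => 0, by simp, by simpa using h⟩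
  | insert a s ha ih =>
    rw [Finset.sum_insert ha] at h
    obtain ⟨P, hP, hNP⟩ := ih (N := N - M a) (tsub_le_iff_left.2 h)
    refine ⟨Function.update P a (N ∩ M a), ?_, ?_⟩
    · intro i hi
      by_cases hia : i = a
      · subst hia
        simpa using Multiset.inter_le_right
      · simpa [hia] using hP i (Finset.mem_of_mem_insert_of_ne hi hia)
    · rw [Finset.sum_insert ha, Function.update_self]
      have : ∑ i ∈ s, Function.update P a (N ∩ M a) i = ∑ i ∈ s, P i := by
        refine Finset.sum_congr rfl fun i hi => ?_
        rw [Function.update_of_ne]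
        rintro rfl
        exact ha hi
      rw [this, ← hNP]
      ext b
      simp only [Multiset.count_add, Multiset.count_inter, Multiset.count_sub]
      omega

/-- A nonempty multiset of Graver basis elements of `A2` whose sum is annihilated by `A1`, and
which is minimal with these properties. -/
def IsMinimalZeroSum {ρ σ τ : Type*} [Fintype τ] (A1 : Matrix ρ τ ℤ) (A2 : Matrix σ τ ℤ)
    (M : Multiset (τ → ℤ)) : Prop :=
  M ≠ 0 ∧ (∀ h ∈ M, h ∈ GraverBasis A2) ∧ A1.mulVec M.sum = 0 ∧
    ∀ N ≤ M, N ≠ 0 → A1.mulVec N.sum = 0 → N = M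

theorem finite_setOf_isMinimalZeroSum {ρ σ τ : Type*} [Fintype τ] (A1 : Matrix ρ τ ℤ)
    (A2 : Matrix σ τ ℤ) : {M | IsMinimalZeroSum A1 A2 M}.Finite := by
  classical
  have := (finite_graverBasis A2).to_subtype
  let φ : Multiset (τ → ℤ) → GraverBasis A2 → ℕ := fun M h => M.count h.1
  have hφ : ∀ M N, IsMinimalZeroSum A1 A2 M → φ M ≤ φ N → M ≤ N := by
    intro M N hM hle
    rw [Multiset.le_iff_count]
    intro h
    by_cases hh : h ∈ GraverBasis A2
    · exact hle ⟨h, hh⟩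
    · rw [Multiset.count_eq_zero_of_notMem fun hm => hh (hM.2.1 h hm)]
      exact Nat.zero_le _
  refine Set.Finite.of_finite_image (f := φ) ?_ ?_
  · refine WellQuasiOrderedLE.finite_of_isAntichain ?_
    rintro _ ⟨M, hM, rfl⟩ _ ⟨N, hN, rfl⟩ hne hle
    exact hne (congrArg φ (hN.2.2.2 M (hφ M N hM hle) hM.1 hM.2.2.1))
  · intro M hM N hN heq
    exact le_antisymm (hφ M N hM heq.le) (hφ N M hN heq.ge)

theorem nFold_mulVec_eq_zero_iff {r s : ℕ} {τ ι : Type*} [Fintype τ] [Fintype ι] [DecidableEq ι]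
    (A1 : Matrix (Fin r) τ ℤ) (A2 : Matrix (Fin s) τ ℤ) (x : ι × τ → ℤ) :
    (nFold A1 A2 ι).mulVec x = 0 ↔
      A1.mulVec (∑ i, brick x i) = 0 ∧ ∀ i, A2.mulVec (brick x i) = 0 := by
  have h1 : ∀ a, (nFold A1 A2 ι).mulVec x (Sum.inl a) = A1.mulVec (∑ i, brick x i) a := by
    intro a
    rw [Matrix.mulVec_sum, Finset.sum_apply]
    simp [Matrix.mulVec, dotProduct, nFold, Fintype.sum_prod_type, brick]
  have h2 : ∀ k c, (nFold A1 A2 ι).mulVec x (Sum.inr (k, c)) = A2.mulVec (brick x k) c := by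
    intro k c
    simp only [Matrix.mulVec, dotProduct, nFold, Fintype.sum_prod_type, brick, Matrix.of_apply]
    rw [Finset.sum_eq_single k]
    · simp
    · intro b _ hb
      simp [hb]
    · simp
  constructor
  · intro h
    exact ⟨funext fun a => by rw [← h1, h]; rfl, fun i => funext fun c => by rw [← h2, h]; rfl⟩
  · rintro ⟨ha, hb⟩
    funext i
    rcases i with a | ⟨k, c⟩
    · rw [h1, ha]; rfl
    · rw [h2, hb]; rfl

theorem eq_of_brick_eq {ι τ : Type*} {x y : ι × τ → ℤ} (h : ∀ i, brick x i = brick y i) :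
    x = y :=
  funext fun p => congrFun (h p.1) p.2

/-- Decomposing the bricks of a Graver basis element of an `n`-fold product conformally into
Graver basis elements of `A2` yields a minimal zero-sum multiset. -/
theorem exists_isMinimalZeroSum_of_mem_graverBasis {r s : ℕ} {τ ι : Type*} [Fintype τ]
    [Fintype ι] [DecidableEq ι] (A1 : Matrix (Fin r) τ ℤ) (A2 : Matrix (Fin s) τ ℤ)
    {g : ι × τ → ℤ} (hg : g ∈ GraverBasis (nFold A1 A2 ι)) :
    ∃ M : ι → Multiset (τ → ℤ), (∀ i, (M i).sum = brick g i) ∧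
      IsMinimalZeroSum A1 A2 (∑ i, M i) := by
  obtain ⟨hker, hg0, hmin⟩ := hg
  rw [nFold_mulVec_eq_zero_iff] at hker
  choose M hM hMc hMs using fun i =>
    exists_conformal_graver_decomposition A2 (brick g i) (hker.2 i)
  have hsc : ∀ i, ∀ x ∈ M i, SignCompatible x (brick g i) := fun i x hx =>
    (hMc i x hx).signCompatible
  refine ⟨M, hMs, ?_, ?_, ?_, ?_⟩
  · intro h0
    refine hg0 (eq_of_brick_eq fun i => ?_)
    have : M i = 0 := (Finset.sum_eq_zero_iff.1 h0) i (Finset.mem_univ i)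
    rw [← hMs i, this]
    rfl
  · intro h hh
    obtain ⟨i, -, hi⟩ := Multiset.mem_sum.1 hh
    exact hM i h hi
  · rw [Multiset.sum_sum, Finset.sum_congr rfl fun i _ => hMs i]
    exact hker.1
  · intro N hN hN0 hNs
    obtain ⟨P, hP, rfl⟩ := exists_le_eq_sum_of_le_sum _ M hN
    replace hP := fun i => hP i (Finset.mem_univ i)
    have hPsc : ∀ i, ∀ x ∈ P i, SignCompatible x (brick g i) := fun i x hx =>
      hsc i x (Multiset.mem_of_le (hP i) hx)
    have hPG : ∀ i, ∀ x ∈ P i, x ∈ GraverBasis A2 := fun i x hx =>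
      hM i x (Multiset.mem_of_le (hP i) hx)
    let y : ι × τ → ℤ := fun p => (P p.1).sum p.2
    have hy : ∀ i, brick y i = (P i).sum := fun i => rfl
    have hyg : y = g := by
      refine hmin y ?_ ?_ ?_
      · rw [nFold_mulVec_eq_zero_iff]
        constructor
        · simpa only [hy, Multiset.sum_sum] using hNs
        · intro i
          rw [hy]
          refine Multiset.sum_induction (fun x => A2.mulVec x = 0) _ ?_ (by simp)
            (fun x hx => (hPG i x hx).1)
          intro a b ha hb
          rw [Matrix.mulVec_add, ha, hb, add_zero]
      · intro hy0
        refine hN0 (Finset.sum_eq_zero fun i _ => ?_)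
        refine eq_zero_of_multiset_sum_eq_zero (hPsc i) (fun x hx => (hPG i x hx).2.1) ?_
        rw [← hy, hy0]
        rfl
      · rintro ⟨i, j⟩
        have := conformalLe_multiset_sum_of_le (hsc i) (hP i) j
        rwa [hMs i] at this
    refine Finset.sum_congr rfl fun i _ => ?_
    obtain ⟨K, hK⟩ := Multiset.le_iff_exists_add.1 (hP i)
    have hKM : K ≤ M i := hK ▸ Multiset.le_add_left _ _
    have hK0 : K = 0 := by
      refine eq_zero_of_multiset_sum_eq_zero
        (fun x hx => hsc i x (Multiset.mem_of_le hKM hx))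
        (fun x hx => (hM i x (Multiset.mem_of_le hKM hx)).2.1) ?_
      have h1 := hMs i
      rw [hK, Multiset.sum_add, ← hy, hyg] at h1
      simpa using h1
    rw [hK, hK0, add_zero]

/-- The elements of a minimal zero-sum multiset are the bricks of a Graver basis element. -/
theorem IsMinimalZeroSum.exists_mem_graverBasis {r s : ℕ} {τ : Type*} [Fintype τ]
    {A1 : Matrix (Fin r) τ ℤ} {A2 : Matrix (Fin s) τ ℤ} {M : Multiset (τ → ℤ)}
    (hM : IsMinimalZeroSum A1 A2 M) :
    ∃ g : Fin M.card × τ → ℤ, g ∈ GraverBasis (nFold A1 A2 (Fin M.card)) ∧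
      ∀ i, brick g i ≠ 0 := by
  classical
  obtain ⟨hM0, hMG, hMs, hmin⟩ := hM
  obtain ⟨m, f, hm, hf⟩ : ∃ (m : ℕ) (f : Fin m → τ → ℤ), m = M.card ∧
      Finset.univ.val.map f = M := by
    refine ⟨M.toList.length, M.toList.get, by simp, ?_⟩
    rw [Fin.univ_val_map, List.ofFn_get, Multiset.coe_toList]
  rw [← hm]
  have hfG : ∀ i, f i ∈ GraverBasis A2 := fun i => hMG _ (by simp [← hf])
  have hsum : M.sum = ∑ i, f i := by rw [← hf]; rfl
  have hbrick : ∀ i, brick (fun p : Fin m × τ => f p.1 p.2) i = f i := fun i => rfl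
  refine ⟨fun p => f p.1 p.2, ⟨?_, ?_, ?_⟩, fun i => (hfG i).2.1⟩
  · rw [nFold_mulVec_eq_zero_iff]
    simp only [hbrick]
    exact ⟨hsum ▸ hMs, fun i => (hfG i).1⟩
  · intro h0
    have hpos : 0 < m := by rw [hm]; exact Multiset.card_pos.2 hM0
    refine (hfG ⟨0, hpos⟩).2.1 ?_
    rw [← hbrick, h0]
    rfl
  · intro y hy hy0 hyf
    rw [nFold_mulVec_eq_zero_iff] at hy
    let S : Finset (Fin m) := {i | brick y i ≠ 0}
    have hS : ∀ i ∈ S, brick y i = f i := by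
      intro i hi
      exact (hfG i).2.2 _ (hy.2 i) (by simpa [S] using hi) fun j => hyf (i, j)
    have hSy : (S.val.map f).sum = ∑ i, brick y i := by
      change ∑ i ∈ S, f i = _
      rw [← Finset.sum_congr rfl hS]
      refine Finset.sum_subset (Finset.subset_univ S) fun i _ hi => ?_
      simpa [S] using hi
    have hSM : S.val.map f = M := by
      refine hmin _ ?_ ?_ (hSy ▸ hy.1)
      · rw [← hf]
        exact Multiset.map_le_map (Finset.val_le_iff.2 (Finset.subset_univ S))
      · intro h0
        have hS0 : S = ∅ := by simpa using h0
        refine hy0 (eq_of_brick_eq fun i => ?_)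
        have : i ∉ S := by simp [hS0]
        have : brick y i = 0 := by simpa [S] using this
        exact this
    have hSu : S = Finset.univ := by
      rw [← Finset.card_eq_iff_eq_univ, Fintype.card_fin]
      exact (Multiset.card_map f S.val).symm.trans ((congrArg Multiset.card hSM).trans hm.symm)
    exact eq_of_brick_eq fun i => hS i (hSu ▸ Finset.mem_univ i)

theorem bddAbove_card_nonzero_bricks {r s t : ℕ} (A1 : Matrix (Fin r) (Fin t) ℤ)
    (A2 : Matrix (Fin s) (Fin t) ℤ) :
    BddAbove {k : ℕ | ∃ (n : ℕ) (g : Fin n × Fin t → ℤ),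
      g ∈ GraverBasis (nFold A1 A2 (Fin n)) ∧ k = {i : Fin n | brick g i ≠ 0}.ncard} := by
  classical
  obtain ⟨B, hB⟩ := ((finite_setOf_isMinimalZeroSum A1 A2).image Multiset.card).bddAbove
  refine ⟨B, ?_⟩
  rintro _ ⟨n, g, hg, rfl⟩
  obtain ⟨M, hMs, hM⟩ := exists_isMinimalZeroSum_of_mem_graverBasis A1 A2 hg
  refine le_trans ?_ (hB ⟨_, hM, rfl⟩)
  rw [Set.ncard_eq_toFinset_card', Finset.card_eq_sum_ones, Multiset.card_sum]
  refine le_trans (Finset.sum_le_sum fun i hi => ?_)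
    (Finset.sum_le_sum_of_subset (Finset.subset_univ _))
  refine Multiset.card_pos.2 fun h0 => ?_
  have h1 := hMs i
  rw [h0, Multiset.sum_zero] at h1
  simp [← h1] at hi

theorem IsMinimalZeroSum.card_le_graverComplexity {r s t : ℕ} {A1 : Matrix (Fin r) (Fin t) ℤ}
    {A2 : Matrix (Fin s) (Fin t) ℤ} {M : Multiset (Fin t → ℤ)}
    (hM : IsMinimalZeroSum A1 A2 M) : M.card ≤ graverComplexity A1 A2 := by
  obtain ⟨g, hg, hne⟩ := hM.exists_mem_graverBasis
  refine le_csSup (bddAbove_card_nonzero_bricks A1 A2) ⟨_, g, hg, ?_⟩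
  simp [hne, Set.ncard_univ]

/-- Every brick of a Graver basis element of an `n`-fold product lies in `Z(A)`. -/
theorem brick_mem_ZSet {r s t n : ℕ} (A1 : Matrix (Fin r) (Fin t) ℤ)
    (A2 : Matrix (Fin s) (Fin t) ℤ) {g : Fin n × Fin t → ℤ}
    (hg : g ∈ GraverBasis (nFold A1 A2 (Fin n))) (i : Fin n) : brick g i ∈ ZSet A1 A2 := by
  obtain ⟨M, hMs, hM⟩ := exists_isMinimalZeroSum_of_mem_graverBasis A1 A2 hg
  have hle : M i ≤ ∑ k, M k := Finset.single_le_sum_of_canonicallyOrdered (Finset.mem_univ i)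
  refine ⟨(M i).toList, ?_, ?_, ?_⟩
  · rw [Multiset.length_toList]
    exact (Multiset.card_le_card hle).trans hM.card_le_graverComplexity
  · intro h hh
    exact hM.2.1 h (Multiset.mem_of_le hle (Multiset.mem_toList.1 hh))
  · rw [Multiset.sum_toList, hMs]

/-- If `ḡ ∈ 𝒢(A⁽ⁿ⁾)` is nonzero, `l ≤ x + ḡ ≤ u`, and `γ̄` is the
largest positive integer with `l ≤ x + γ̄ ḡ ≤ u`, then there is a brick index `i` with
`ḡⁱ ≠ 0`, `ḡⁱ ∈ Z(A)`, and `γ̄` the largest positive integer `γ` with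
`lⁱ ≤ xⁱ + γ ḡⁱ ≤ uⁱ`. -/
theorem critical_stepsize_attained_on_brick {r s t n : ℕ}
    (A1 : Matrix (Fin r) (Fin t) ℤ) (A2 : Matrix (Fin s) (Fin t) ℤ)
    (l u x : Fin n × Fin t → ℤ) (hxl : l ≤ x) (hxu : x ≤ u)
    (gbar : Fin n × Fin t → ℤ) (hgbar : gbar ∈ GraverBasis (nFold A1 A2 (Fin n)))
    (hne : gbar ≠ 0) (hl1 : l ≤ x + gbar) (hu1 : x + gbar ≤ u)
    (γbar : ℕ) (hγbar : 0 < γbar)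
    (hγl : l ≤ x + (γbar : ℤ) • gbar) (hγu : x + (γbar : ℤ) • gbar ≤ u)
    (hγmax : ∀ γ : ℕ, 0 < γ → l ≤ x + (γ : ℤ) • gbar → x + (γ : ℤ) • gbar ≤ u →
      γ ≤ γbar) :
    ∃ i : Fin n, brick gbar i ≠ 0 ∧ brick gbar i ∈ ZSet A1 A2 ∧
      (∀ j, l (i, j) ≤ x (i, j) + (γbar : ℤ) * gbar (i, j) ∧
        x (i, j) + (γbar : ℤ) * gbar (i, j) ≤ u (i, j)) ∧
      ∀ γ : ℕ, 0 < γ →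
        (∀ j, l (i, j) ≤ x (i, j) + (γ : ℤ) * gbar (i, j) ∧
          x (i, j) + (γ : ℤ) * gbar (i, j) ≤ u (i, j)) →
        γ ≤ γbar := by
  have hγ : ∀ i j, l (i, j) ≤ x (i, j) + (γbar : ℤ) * gbar (i, j) ∧
      x (i, j) + (γbar : ℤ) * gbar (i, j) ≤ u (i, j) := fun i j => ⟨hγl (i, j), hγu (i, j)⟩
  obtain ⟨i, j, hij⟩ : ∃ i j, ¬ (l (i, j) ≤ x (i, j) + ((γbar : ℤ) + 1) * gbar (i, j) ∧
      x (i, j) + ((γbar : ℤ) + 1) * gbar (i, j) ≤ u (i, j)) := by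
    by_contra! hcon
    have := hγmax (γbar + 1) (Nat.succ_pos _)
      (fun p => by simpa using (hcon p.1 p.2).1) (fun p => by simpa using (hcon p.1 p.2).2)
    omega
  refine ⟨i, ?_, brick_mem_ZSet A1 A2 hgbar i, hγ i, ?_⟩
  · intro h0
    have hz : gbar (i, j) = 0 := congrFun h0 j
    refine hij ?_
    have := hγ i j
    rw [hz, mul_zero] at this ⊢
    exact this
  · intro γ _ hfeas
    by_contra! hlt
    have hlt' : (γbar : ℤ) + 1 ≤ γ := by exact_mod_cast hlt
    have h1 := hγ i j
    have h2 := hfeas j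
    refine hij ?_
    rcases le_total 0 (gbar (i, j)) with hs | hs <;> constructor <;> nlinarith
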